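/- arXiv:1611.02463 — 2 statements merged into one kernel-verified Lean document; each statement's English description precedes it below -/
import Mathlib

section
/- Fix α > 0, c > 0, a full-column-rank H ∈ ℂ^{N×N_U} with pseudo-inverse H† and projection P = I_N − H H†, and H' ∈ ℂ^{N×N_U}. The function f(B̃) = α tr[(H†H' + B̃PH')(H†H' + B̃PH')^H] + c tr[(H^H H)^{-1} + B̃ P B̃^H] over B̃ ∈ ℂ^{N_U×N} attains its minimum at any B̃ with B̃P = −H†H'(H'^H P H' + (c/α) I_{N_U})^{-1} H'^H P. -/
open Matrix

theorem isHermitian_one_sub_mul_inv_mul {m n : Type*} [Fintype m] [Fintype n] [DecidableEq m]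
    [DecidableEq n] (H : Matrix m n ℂ) :
    (1 - H * ((Hᴴ * H)⁻¹ * Hᴴ)).IsHermitian := by
  simp [Matrix.IsHermitian, conjTranspose_sub, conjTranspose_mul, conjTranspose_nonsing_inv,
    Matrix.mul_assoc]

theorem isIdempotentElem_one_sub_mul_inv_mul {m n : Type*} [Fintype m] [Fintype n] [DecidableEq m]
    [DecidableEq n] (H : Matrix m n ℂ) :
    IsIdempotentElem (1 - H * ((Hᴴ * H)⁻¹ * Hᴴ)) := by
  apply IsIdempotentElem.one_sub
  by_cases h : IsUnit (Hᴴ * H).det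
  · calc H * ((Hᴴ * H)⁻¹ * Hᴴ) * (H * ((Hᴴ * H)⁻¹ * Hᴴ))
        = H * (((Hᴴ * H)⁻¹ * (Hᴴ * H)) * ((Hᴴ * H)⁻¹ * Hᴴ)) := by
          simp only [Matrix.mul_assoc]
      _ = H * ((Hᴴ * H)⁻¹ * Hᴴ) := by rw [nonsing_inv_mul _ h, Matrix.one_mul]
  · simp [IsIdempotentElem, nonsing_inv_apply_not_isUnit _ h]

open scoped ComplexOrder in
theorem isUnit_det_conjTranspose_mul_mul_add_smul_one {m n : Type*} [Fintype m] [Fintype n]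
    [DecidableEq n] {P : Matrix m m ℂ} (hPh : P.IsHermitian)
    (hP : IsIdempotentElem P) (K : Matrix m n ℂ) {r : ℝ} (hr : 0 < r) :
    IsUnit (Kᴴ * P * K + (r : ℂ) • (1 : Matrix n n ℂ)).det := by
  have hK : Kᴴ * P * K = (P * K)ᴴ * (P * K) := by
    rw [conjTranspose_mul, hPh.eq, Matrix.mul_assoc, Matrix.mul_assoc, ← Matrix.mul_assoc P P K,
      hP.eq]
  rw [hK]
  have h1 : ((r : ℂ) • (1 : Matrix n n ℂ)).PosDef :=
    Matrix.PosDef.one.smul (by exact_mod_cast hr)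
  exact (Matrix.isUnit_iff_isUnit_det _).1
    (Matrix.PosDef.posSemidef_add (Matrix.posSemidef_conjTranspose_mul_self (P * K)) h1).isUnit

open scoped ComplexOrder in
theorem re_trace_mul_conjTranspose_self_nonneg {m n : Type*} [Fintype m] [Fintype n]
    (A : Matrix m n ℂ) : 0 ≤ (A * Aᴴ).trace.re :=
  (Complex.le_def.1 (Matrix.posSemidef_self_mul_conjTranspose A).trace_nonneg).1

theorem re_trace_add_mul_conjTranspose_add {m n : Type*} [Fintype m] [Fintype n]
    (A D : Matrix m n ℂ) :
    ((A + D) * (A + D)ᴴ).trace.re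
      = (A * Aᴴ).trace.re + 2 * (A * Dᴴ).trace.re + (D * Dᴴ).trace.re := by
  have h : (D * Aᴴ).trace.re = (A * Dᴴ).trace.re := by
    have h' : D * Aᴴ = (A * Dᴴ)ᴴ := by simp
    rw [h', trace_conjTranspose]
    simp
  simp only [conjTranspose_add, Matrix.add_mul, Matrix.mul_add, trace_add, Complex.add_re, h]
  ring

/-- A stationary point `X` of the regularized least-squares cost
`α ‖A + X K‖² + c ‖X‖²`, along the direction `D`, is a minimum along that direction. -/
theorem regularized_cost_le_of_stationary {l m n : Type*} [Fintype l] [Fintype m] [Fintype n]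
    {α c : ℝ} (hα : 0 < α) (hc : 0 < c) (A : Matrix l n ℂ) (K : Matrix m n ℂ) (X D : Matrix l m ℂ)
    (h : (α : ℂ) • ((A + X * K) * Kᴴ * Dᴴ) + (c : ℂ) • (X * Dᴴ) = 0) :
    α * ((A + X * K) * (A + X * K)ᴴ).trace.re + c * (X * Xᴴ).trace.re
      ≤ α * ((A + (X + D) * K) * (A + (X + D) * K)ᴴ).trace.re
        + c * ((X + D) * (X + D)ᴴ).trace.re := by
  have hcross : α * ((A + X * K) * (D * K)ᴴ).trace.re + c * (X * Dᴴ).trace.re = 0 := by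
    have h' := congrArg (fun M => (trace M).re) h
    simpa [trace_add, trace_smul, conjTranspose_mul, Matrix.mul_assoc] using h'
  rw [Matrix.add_mul X D K, ← add_assoc A, re_trace_add_mul_conjTranspose_add (A + X * K),
    re_trace_add_mul_conjTranspose_add X]
  have h1 := mul_nonneg hα.le (re_trace_mul_conjTranspose_self_nonneg (D * K))
  have h2 := mul_nonneg hc.le (re_trace_mul_conjTranspose_self_nonneg D)
  linarith

/-- The function
`f(B̃) = α tr[(H†H' + B̃PH')(H†H' + B̃PH')ᴴ] + c tr[(Hᴴ H)⁻¹ + B̃ P B̃ᴴ]`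
over `B̃ ∈ ℂ^{N_U×N}` attains its minimum at any `B̃` with
`B̃P = −H†H'(H'ᴴ P H' + (c/α) I)⁻¹ H'ᴴ P`. -/
theorem zf_decoder_optimal {N NU : ℕ} (hN : NU ≤ N) (α c : ℝ) (hα : 0 < α) (hc : 0 < c)
    (H H' : Matrix (Fin N) (Fin NU) ℂ) (hrank : H.rank = NU) :
    let Hdag : Matrix (Fin NU) (Fin N) ℂ := (Hᴴ * H)⁻¹ * Hᴴ
    let P : Matrix (Fin N) (Fin N) ℂ := 1 - H * Hdag
    let f : Matrix (Fin NU) (Fin N) ℂ → ℝ := fun B =>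
      α * (Matrix.trace ((Hdag * H' + B * P * H') * (Hdag * H' + B * P * H')ᴴ)).re
        + c * (Matrix.trace ((Hᴴ * H)⁻¹ + B * P * Bᴴ)).re
    ∀ B₀ : Matrix (Fin NU) (Fin N) ℂ,
      B₀ * P = -(Hdag * H' * (H'ᴴ * P * H' + ((c / α : ℝ) : ℂ) • (1 : Matrix (Fin NU) (Fin NU) ℂ))⁻¹
          * H'ᴴ * P) →
      ∀ B : Matrix (Fin NU) (Fin N) ℂ, f B₀ ≤ f B := by
  intro Hdag P f B₀ hB₀ B
  have hPh : P.IsHermitian := isHermitian_one_sub_mul_inv_mul H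
  have hP : P * P = P := isIdempotentElem_one_sub_mul_inv_mul H
  have hM := isUnit_det_conjTranspose_mul_mul_add_smul_one hPh hP H' (div_pos hc hα)
  set M := H'ᴴ * P * H' + ((c / α : ℝ) : ℂ) • (1 : Matrix (Fin NU) (Fin NU) ℂ) with hMdef
  have hquad (C : Matrix (Fin NU) (Fin N) ℂ) : C * P * Cᴴ = C * P * (C * P)ᴴ := by
    rw [conjTranspose_mul, hPh.eq, Matrix.mul_assoc C P (P * Cᴴ), ← Matrix.mul_assoc P P, hP,
      Matrix.mul_assoc]
  have hres : Hdag * H' + B₀ * P * H' = ((c / α : ℝ) : ℂ) • (Hdag * H' * M⁻¹) := by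
    have hsplit : H'ᴴ * P * H' = M - ((c / α : ℝ) : ℂ) • 1 := by simp [hMdef]
    calc Hdag * H' + B₀ * P * H' = Hdag * H' - Hdag * H' * M⁻¹ * (H'ᴴ * P * H') := by
          rw [hB₀, Matrix.neg_mul, ← sub_eq_add_neg]
          simp only [Matrix.mul_assoc]
      _ = ((c / α : ℝ) : ℂ) • (Hdag * H' * M⁻¹) := by
          rw [hsplit, Matrix.mul_sub, nonsing_inv_mul_cancel_right _ _ hM, Matrix.mul_smul,
            Matrix.mul_one, sub_sub_cancel]
  have hD : ((B - B₀) * P)ᴴ = P * (B - B₀)ᴴ := by rw [conjTranspose_mul, hPh.eq]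
  have hαc : (α : ℂ) * ((c / α : ℝ) : ℂ) = c := by
    rw [← Complex.ofReal_mul, mul_div_cancel₀ _ hα.ne']
  have hstat : (α : ℂ) • ((Hdag * H' + B₀ * P * H') * H'ᴴ * ((B - B₀) * P)ᴴ)
      + (c : ℂ) • (B₀ * P * ((B - B₀) * P)ᴴ) = 0 := by
    have hBP : B₀ * P * ((B - B₀) * P)ᴴ
        = -(Hdag * H' * M⁻¹ * H'ᴴ * ((B - B₀) * P)ᴴ) := by
      rw [hB₀, hD, Matrix.neg_mul, Matrix.mul_assoc _ P, ← Matrix.mul_assoc P P, hP]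
    rw [hBP, hres, Matrix.smul_mul, Matrix.smul_mul, smul_smul, hαc, smul_neg, add_neg_cancel]
  have key := regularized_cost_le_of_stationary hα hc (Hdag * H') H' (B₀ * P) ((B - B₀) * P) hstat
  rw [← Matrix.add_mul B₀ (B - B₀) P, add_sub_cancel] at key
  simp only [f, trace_add, Complex.add_re, hquad]
  linarith
end

section
/- If H_UL ∈ ℂ^{N×N_U} has full column rank, H' ∈ ℂ^{N×N_U} is arbitrary, P = I_N − H_UL H_UL† with rank N − N_U < N_U, and P = U₂U₂^H with U₂ ∈ ℂ^{N×(N−N_U)} having orthonormal columns and U₂^H H' H'^H U₂ invertible, then lim_{c→0} [−H†H'(H'^HPH' + cI_{N_U})^{-1}H'^H] P = −H†H'H'^HU₂(U₂^HH'H'^HU₂)^{-1}U₂^H. -/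
open Matrix Filter

/-- The push-through identity `(AB + c)⁻¹A = A(BA + c)⁻¹`. -/
theorem Matrix.inv_add_smul_one_mul_comm {m n R : Type*} [Fintype m] [DecidableEq m] [Fintype n]
    [DecidableEq n] [CommRing R] (A : Matrix m n R) (B : Matrix n m R) (c : R)
    (h₁ : IsUnit (A * B + c • (1 : Matrix m m R)).det)
    (h₂ : IsUnit (B * A + c • (1 : Matrix n n R)).det) :
    (A * B + c • (1 : Matrix m m R))⁻¹ * A = A * (B * A + c • (1 : Matrix n n R))⁻¹ := by
  have key : A * (B * A + c • (1 : Matrix n n R)) = (A * B + c • (1 : Matrix m m R)) * A := by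
    simp [Matrix.mul_add, Matrix.add_mul, Matrix.mul_assoc]
  calc (A * B + c • (1 : Matrix m m R))⁻¹ * A
      = (A * B + c • (1 : Matrix m m R))⁻¹ * (A * (B * A + c • (1 : Matrix n n R)))
          * (B * A + c • (1 : Matrix n n R))⁻¹ := by
        rw [Matrix.mul_assoc, Matrix.mul_nonsing_inv_cancel_right _ _ h₂]
    _ = A * (B * A + c • (1 : Matrix n n R))⁻¹ := by
        rw [key, Matrix.nonsing_inv_mul_cancel_left _ _ h₁]

open scoped ComplexOrder in
/-- A Gram matrix shifted by a positive multiple of the identity is invertible. -/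
theorem Matrix.isUnit_det_conjTranspose_mul_self_add_smul_one {m n : Type*} [Fintype m]
    [Fintype n] [DecidableEq n] (B : Matrix m n ℂ) {c : ℝ} (hc : 0 < c) :
    IsUnit (Bᴴ * B + (c : ℂ) • (1 : Matrix n n ℂ)).det := by
  have hc' : (0 : ℂ) < (c : ℂ) := by exact_mod_cast hc
  rw [← Matrix.isUnit_iff_isUnit_det]
  exact (Matrix.PosDef.posSemidef_add (Matrix.posSemidef_conjTranspose_mul_self B)
    (Matrix.PosDef.one.smul hc')).isUnit

/-- High-SNR limit of the ZF decoder when `N − N_U < N_U`: if `H` has full column rank,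
`P = I − H H† = U₂ U₂ᴴ` with `U₂` having orthonormal columns and `U₂ᴴ H' H'ᴴ U₂`
invertible, then as `c → 0⁺`,
`[−H†H'(H'ᴴPH' + cI)⁻¹H'ᴴ] P → −H†H'H'ᴴU₂(U₂ᴴH'H'ᴴU₂)⁻¹U₂ᴴ`. -/
theorem zf_decoder_high_snr_limit {N NU : ℕ} (hN : NU ≤ N) (hdim : N - NU < NU)
    (H H' : Matrix (Fin N) (Fin NU) ℂ) (hrank : H.rank = NU)
    (U2 : Matrix (Fin N) (Fin (N - NU)) ℂ) (hU2 : U2ᴴ * U2 = 1)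
    (hP : (1 : Matrix (Fin N) (Fin N) ℂ) - H * ((Hᴴ * H)⁻¹ * Hᴴ) = U2 * U2ᴴ)
    (hinv : IsUnit (U2ᴴ * H' * H'ᴴ * U2).det) :
    let Hdag : Matrix (Fin NU) (Fin N) ℂ := (Hᴴ * H)⁻¹ * Hᴴ
    let P : Matrix (Fin N) (Fin N) ℂ := 1 - H * Hdag
    Tendsto
      (fun c : ℝ =>
        -(Hdag * H' * (H'ᴴ * P * H' + (c : ℂ) • (1 : Matrix (Fin NU) (Fin NU) ℂ))⁻¹ * H'ᴴ) * P)
      (nhdsWithin (0 : ℝ) (Set.Ioi 0))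
      (nhds (-(Hdag * H' * H'ᴴ * U2 * (U2ᴴ * H' * H'ᴴ * U2)⁻¹ * U2ᴴ))) := by
  intro Hdag P
  have hP' : P = U2 * U2ᴴ := hP
  have hB : U2ᴴ * H' * H'ᴴ * U2 = (U2ᴴ * H') * (U2ᴴ * H')ᴴ := by
    simp [Matrix.conjTranspose_mul, Matrix.mul_assoc]
  rw [hB] at hinv ⊢
  have hBH : H'ᴴ * U2 = (U2ᴴ * H')ᴴ := by simp [Matrix.conjTranspose_mul]
  have hPB : H'ᴴ * P * H' = (U2ᴴ * H')ᴴ * (U2ᴴ * H') := by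
    simp [hP', Matrix.conjTranspose_mul, Matrix.mul_assoc]
  rw [Matrix.mul_assoc (Hdag * H') H'ᴴ U2, hBH, hPB, hP']
  generalize hBdef : U2ᴴ * H' = B at *
  have hlim : Tendsto (fun c : ℝ => (B * Bᴴ + (c : ℂ) • (1 : Matrix _ _ ℂ))⁻¹)
      (nhdsWithin (0 : ℝ) (Set.Ioi 0)) (nhds (B * Bᴴ)⁻¹) := by
    have hshift : Tendsto (fun c : ℝ => B * Bᴴ + (c : ℂ) • (1 : Matrix _ _ ℂ))
        (nhds 0) (nhds (B * Bᴴ)) := by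
      have hcont : Continuous (fun c : ℝ => B * Bᴴ + (c : ℂ) • (1 : Matrix _ _ ℂ)) := by
        fun_prop
      simpa using hcont.tendsto 0
    have hdet : ContinuousAt Ring.inverse (B * Bᴴ).det := by
      rw [Ring.inverse_eq_inv']
      exact continuousAt_inv₀ hinv.ne_zero
    exact ((continuousAt_matrix_inv _ hdet).tendsto.comp hshift).mono_left
      nhdsWithin_le_nhds
  have hcont : Continuous (fun X : Matrix (Fin (N - NU)) (Fin (N - NU)) ℂ => -(Hdag * H' * Bᴴ * X * U2ᴴ)) := by fun_prop
  refine ((hcont.tendsto _).comp hlim).congr' ?_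
  filter_upwards [self_mem_nhdsWithin] with c hc
  have h₁ := Matrix.isUnit_det_conjTranspose_mul_self_add_smul_one B hc
  have h₂ := Matrix.isUnit_det_conjTranspose_mul_self_add_smul_one Bᴴ hc
  rw [Matrix.conjTranspose_conjTranspose] at h₂
  have key := Matrix.inv_add_smul_one_mul_comm Bᴴ B (c : ℂ) h₁ h₂
  calc -(Hdag * H' * Bᴴ * (B * Bᴴ + (c : ℂ) • (1 : Matrix _ _ ℂ))⁻¹ * U2ᴴ)
      = -(Hdag * H' * (Bᴴ * (B * Bᴴ + (c : ℂ) • (1 : Matrix _ _ ℂ))⁻¹) * U2ᴴ) := by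
        simp only [Matrix.mul_assoc]
    _ = -(Hdag * H' * (Bᴴ * B + (c : ℂ) • (1 : Matrix _ _ ℂ))⁻¹ * H'ᴴ) * (U2 * U2ᴴ) := by
        rw [← key, ← hBH]
        simp only [Matrix.mul_assoc, Matrix.neg_mul]
end
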